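/- For odd n, let MAJ_n : {0,1}^n → {0,1} be the majority function MAJ_n(x_1,…,x_n) = 1 if Σ_{i=1}^n x_i ≥ (n+1)/2 and 0 otherwise. The sequence {MAJ_n} (over odd n) is noise stable with respect to p_n ≡ 1/2. -/

import Mathlib

open MeasureTheory

/-- The Bernoulli(p) measure on `Bool` (probability `p` of `true`). -/
noncomputable def bern (p : ℝ) : Measure Bool :=
  ENNReal.ofReal p • Measure.dirac true + ENNReal.ofReal (1 - p) • Measure.dirac false

/-- Joint law of (ω_i, fresh bit, resample indicator) per coordinate. -/
noncomputable def noiseμ (m : ℕ) (p ε : ℝ) : Measure (Fin m → Bool × Bool × Bool) :=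
  Measure.pi fun _ => (bern p).prod ((bern p).prod (bern ε))

/-- The original configuration ω. -/
def obs {m : ℕ} (σ : Fin m → Bool × Bool × Bool) : Fin m → Bool := fun i => (σ i).1

/-- The noised configuration ω^ε. -/
def pert {m : ℕ} (σ : Fin m → Bool × Bool × Bool) : Fin m → Bool :=
  fun i => if (σ i).2.2 then (σ i).2.1 else (σ i).1

/-- The majority function on `2n+1` bits (the odd number of bits): output 1 iff at least
`n+1` of the bits are 1, i.e. Σ x_i ≥ ((2n+1)+1)/2. -/
def maj (n : ℕ) (x : Fin (2*n+1) → Bool) : Bool :=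
  decide (n + 1 ≤ ∑ i : Fin (2*n+1), (if x i then 1 else 0))

open ProbabilityTheory

/-- The number of `true` coordinates of a configuration. -/
def trueCount {m : ℕ} (x : Fin m → Bool) : ℕ := ∑ i, if x i then 1 else 0

/-- The change of the value of one coordinate caused by the noise. -/
def coordChange (s : Bool × Bool × Bool) : ℝ :=
  (if (if s.2.2 then s.2.1 else s.1) then 1 else 0) - (if s.1 then 1 else 0)

lemma isProbabilityMeasure_bern {p : ℝ} (h0 : 0 ≤ p) (h1 : p ≤ 1) :
    IsProbabilityMeasure (bern p) := by
  constructor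
  simp only [bern, Measure.coe_add, Measure.coe_smul, Pi.add_apply, Pi.smul_apply,
    measure_univ, smul_eq_mul, mul_one]
  rw [← ENNReal.ofReal_add h0 (sub_nonneg.2 h1)]
  simp

lemma bern_half_singleton (b : Bool) : bern (1 / 2) {b} = 2⁻¹ := by
  have h : ENNReal.ofReal (1 / 2) = 2⁻¹ := by
    rw [one_div, ENNReal.ofReal_inv_of_pos two_pos, ENNReal.ofReal_ofNat]
  have h' : ENNReal.ofReal (1 - 1 / 2) = 2⁻¹ := by
    rw [show (1 - 1 / 2 : ℝ) = 1 / 2 by norm_num, h]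
  cases b <;> simp [bern, h', -one_div, h]

lemma integral_bern {p : ℝ} (h0 : 0 ≤ p) (h1 : p ≤ 1) (f : Bool → ℝ) :
    ∫ b, f b ∂(bern p) = p * f true + (1 - p) * f false := by
  rw [bern, integral_add_measure (Integrable.of_finite.smul_measure ENNReal.ofReal_ne_top)
    (Integrable.of_finite.smul_measure ENNReal.ofReal_ne_top), integral_smul_measure,
    integral_smul_measure, integral_dirac, integral_dirac, ENNReal.toReal_ofReal h0,
    ENNReal.toReal_ofReal (sub_nonneg.2 h1)]
  simp

lemma centralBinom_sq_mul_le (n : ℕ) : n.centralBinom ^ 2 * (2 * n + 1) ≤ 16 ^ n := by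
  induction n with
  | zero => simp
  | succ n ih =>
    have h := Nat.succ_mul_centralBinom_succ n
    refine le_of_mul_le_mul_left ?_ (show 0 < (n + 1) ^ 2 by positivity)
    calc (n + 1) ^ 2 * ((n + 1).centralBinom ^ 2 * (2 * (n + 1) + 1))
        = ((n + 1) * (n + 1).centralBinom) ^ 2 * (2 * n + 3) := by ring
      _ = 4 * ((2 * n + 1) * (2 * n + 3)) * (n.centralBinom ^ 2 * (2 * n + 1)) := by
        rw [h]; ring
      _ ≤ 4 * (4 * (n + 1) ^ 2) * 16 ^ n := by
        refine Nat.mul_le_mul (Nat.mul_le_mul_left 4 ?_) ih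
        nlinarith
      _ = (n + 1) ^ 2 * 16 ^ (n + 1) := by ring

lemma choose_two_mul_add_one_le (n k : ℕ) :
    (2 * n + 1).choose k ≤ 2 * n.centralBinom := by
  cases k with
  | zero =>
    have := n.centralBinom_pos
    rw [Nat.choose_zero_right]
    omega
  | succ k =>
    rw [Nat.choose_succ_succ]
    have h₁ := Nat.choose_le_centralBinom k n
    have h₂ := Nat.choose_le_centralBinom (k + 1) n
    simp only [Nat.succ_eq_add_one]
    omega

lemma choose_div_two_pow_le (n k : ℕ) :
    ((2 * n + 1).choose k : ℝ) / 2 ^ (2 * n + 1) ≤ 1 / √(2 * n + 1) := by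
  have h₁ : ((2 * n + 1).choose k : ℝ) ≤ 2 * n.centralBinom := by
    exact_mod_cast choose_two_mul_add_one_le n k
  have h₂ : (n.centralBinom : ℝ) * √(2 * n + 1) ≤ 4 ^ n := by
    refine le_of_sq_le_sq ?_ (by positivity)
    rw [mul_pow, Real.sq_sqrt (by positivity), ← pow_mul, mul_comm n 2, pow_mul]
    norm_num
    exact_mod_cast centralBinom_sq_mul_le n
  rw [div_le_div_iff₀ (by positivity) (by positivity), pow_succ, pow_mul]
  norm_num
  calc ((2 * n + 1).choose k : ℝ) * √(2 * n + 1)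
      ≤ 2 * n.centralBinom * √(2 * n + 1) := by gcongr
    _ ≤ 4 ^ n * 2 := by linarith

lemma card_trueCount_eq_le (m k : ℕ) :
    (Finset.univ.filter fun x : Fin m → Bool => trueCount x = k).card ≤ m.choose k := by
  have h : (Finset.powersetCard k (Finset.univ : Finset (Fin m))).card = m.choose k := by simp
  rw [← h]
  refine Finset.card_le_card_of_injOn (fun x => Finset.univ.filter fun i => x i = true) ?_ ?_
  · intro x hx
    simpa [trueCount] using hx
  · intro x _ y _ hxy
    funext i
    have := congrArg (i ∈ ·) hxy
    simp only [Finset.mem_filter, Finset.mem_univ, true_and, eq_iff_iff] at this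
    exact Bool.eq_iff_iff.2 this

lemma pi_bern_half_trueCount_eq_le (n k : ℕ) :
    (Measure.pi fun _ : Fin (2 * n + 1) => bern (1 / 2)).real {x | trueCount x = k}
      ≤ 1 / √(2 * n + 1) := by
  have := isProbabilityMeasure_bern (p := 1 / 2) (by norm_num) (by norm_num)
  have hset : {x : Fin (2 * n + 1) → Bool | trueCount x = k}
      = ((Finset.univ.filter fun x => trueCount x = k : Finset (Fin (2 * n + 1) → Bool)) :
        Set (Fin (2 * n + 1) → Bool)) := by ext; simp
  rw [hset, ← sum_measureReal_singleton]
  simp only [Measure.real, Measure.pi_singleton, bern_half_singleton, Finset.prod_const,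
    Finset.card_univ, Fintype.card_fin, Finset.sum_const, nsmul_eq_mul, ENNReal.toReal_pow,
    ENNReal.toReal_inv, ENNReal.toReal_ofNat]
  refine le_trans ?_ (choose_div_two_pow_le n k)
  rw [inv_pow, ← div_eq_mul_inv]
  gcongr
  exact_mod_cast card_trueCount_eq_le _ k

lemma isProbabilityMeasure_noiseμ (m : ℕ) {p ε : ℝ} (hp0 : 0 ≤ p) (hp1 : p ≤ 1)
    (h0 : 0 ≤ ε) (h1 : ε ≤ 1) : IsProbabilityMeasure (noiseμ m p ε) := by
  have := isProbabilityMeasure_bern hp0 hp1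
  have := isProbabilityMeasure_bern h0 h1
  unfold noiseμ
  infer_instance

lemma map_obs_noiseμ (m : ℕ) {p ε : ℝ} (hp0 : 0 ≤ p) (hp1 : p ≤ 1)
    (h0 : 0 ≤ ε) (h1 : ε ≤ 1) :
    (noiseμ m p ε).map obs = Measure.pi fun _ => bern p := by
  have := isProbabilityMeasure_bern hp0 hp1
  have := isProbabilityMeasure_bern h0 h1
  have hfst : ((bern p).prod ((bern p).prod (bern ε))).map Prod.fst = bern p := by
    rw [Measure.map_fst_prod]; simp
  have : SigmaFinite (((bern p).prod ((bern p).prod (bern ε))).map Prod.fst) := by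
    rw [hfst]; infer_instance
  have h := Measure.pi_map_pi (μ := fun _ : Fin m => (bern p).prod ((bern p).prod (bern ε)))
    (f := fun _ => Prod.fst) (fun _ => by fun_prop)
  rw [hfst] at h
  exact h

lemma noiseμ_trueCount_obs_eq_le (n k : ℕ) {ε : ℝ} (h0 : 0 ≤ ε) (h1 : ε ≤ 1) :
    (noiseμ (2 * n + 1) (1 / 2) ε).real {σ | trueCount (obs σ) = k} ≤ 1 / √(2 * n + 1) := by
  have h := pi_bern_half_trueCount_eq_le n k
  rw [← map_obs_noiseμ (2 * n + 1) (p := 1 / 2) (by norm_num) (by norm_num) h0 h1,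
    map_measureReal_apply (measurable_of_finite _) (Set.toFinite _).measurableSet] at h
  exact h

lemma cast_trueCount {m : ℕ} (x : Fin m → Bool) :
    (trueCount x : ℝ) = ∑ i, if x i then 1 else 0 := by
  simp [trueCount]

lemma sum_coordChange {m : ℕ} (σ : Fin m → Bool × Bool × Bool) :
    ∑ i, coordChange (σ i) = (trueCount (pert σ) : ℝ) - trueCount (obs σ) := by
  rw [cast_trueCount, cast_trueCount, ← Finset.sum_sub_distrib]
  rfl

lemma integral_coordChange {ε : ℝ} (h0 : 0 ≤ ε) (h1 : ε ≤ 1) :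
    ∫ s, coordChange s ∂((bern (1 / 2)).prod ((bern (1 / 2)).prod (bern ε))) = 0 := by
  have := isProbabilityMeasure_bern (p := 1 / 2) (by norm_num) (by norm_num)
  have := isProbabilityMeasure_bern h0 h1
  rw [integral_prod _ .of_finite, integral_bern (by norm_num) (by norm_num),
    integral_prod _ .of_finite, integral_prod _ .of_finite]
  simp only [integral_bern (p := 1 / 2) (by norm_num) (by norm_num), integral_bern h0 h1]
  simp [coordChange]
  ring

lemma variance_coordChange {ε : ℝ} (h0 : 0 ≤ ε) (h1 : ε ≤ 1) :
    Var[coordChange; (bern (1 / 2)).prod ((bern (1 / 2)).prod (bern ε))] = ε / 2 := by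
  have := isProbabilityMeasure_bern (p := 1 / 2) (by norm_num) (by norm_num)
  have := isProbabilityMeasure_bern h0 h1
  rw [variance_of_integral_eq_zero (measurable_of_finite _).aemeasurable
    (integral_coordChange h0 h1), integral_prod _ .of_finite,
    integral_bern (by norm_num) (by norm_num),
    integral_prod _ .of_finite, integral_prod _ .of_finite]
  simp only [integral_bern (p := 1 / 2) (by norm_num) (by norm_num), integral_bern h0 h1]
  simp [coordChange]
  ring

lemma noiseμ_le_abs_trueCount_sub_le (m : ℕ) {ε t : ℝ} (h0 : 0 ≤ ε) (h1 : ε ≤ 1) (ht : 0 < t) :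
    (noiseμ m (1 / 2) ε).real
      {σ | t ≤ |(trueCount (pert σ) : ℝ) - trueCount (obs σ)|} ≤ m * (ε / 2) / t ^ 2 := by
  have := isProbabilityMeasure_bern (p := 1 / 2) (by norm_num) (by norm_num)
  have := isProbabilityMeasure_bern h0 h1
  have := isProbabilityMeasure_noiseμ m (p := 1 / 2) (by norm_num) (by norm_num) h0 h1
  have hmean : ∫ σ, (∑ i, fun σ : Fin m → Bool × Bool × Bool => coordChange (σ i)) σ
      ∂(noiseμ m (1 / 2) ε) = 0 := by
    simp only [Finset.sum_apply]
    rw [integral_finsetSum _ fun _ _ => .of_finite]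
    refine Finset.sum_eq_zero fun i _ => ?_
    rw [noiseμ, integral_comp_eval (measurable_of_finite coordChange).aestronglyMeasurable]
    exact integral_coordChange h0 h1
  have hvar : Var[∑ i, fun σ : Fin m → Bool × Bool × Bool => coordChange (σ i);
      noiseμ m (1 / 2) ε] = m * (ε / 2) := by
    rw [noiseμ, variance_sum_pi fun _ => MemLp.of_discrete]
    simp only [variance_coordChange h0 h1]
    simp
  have h := meas_ge_le_variance_div_sq (μ := noiseμ m (1 / 2) ε)
    (X := ∑ i, fun σ : Fin m → Bool × Bool × Bool => coordChange (σ i)) MemLp.of_discrete ht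
  rw [hmean, hvar] at h
  simp only [Finset.sum_apply, sum_coordChange, sub_zero] at h
  exact ENNReal.toReal_le_of_le_ofReal (by positivity) h

lemma setOf_maj_obs_ne_maj_pert_subset (n : ℕ) {t : ℝ} (ht : 0 ≤ t) :
    {σ : Fin (2 * n + 1) → Bool × Bool × Bool | maj n (obs σ) ≠ maj n (pert σ)} ⊆
      {σ | t ≤ |(trueCount (pert σ) : ℝ) - trueCount (obs σ)|} ∪
      ⋃ k ∈ Finset.Ico (n + 1 - ⌊t⌋₊) (n + 1 + ⌊t⌋₊), {σ | trueCount (obs σ) = k} := by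
  intro σ hσ
  by_cases hD : t ≤ |(trueCount (pert σ) : ℝ) - trueCount (obs σ)|
  · exact .inl hD
  right
  have hσ' : ¬ (n + 1 ≤ trueCount (obs σ) ↔ n + 1 ≤ trueCount (pert σ)) := by
    simpa [maj, trueCount] using hσ
  rw [not_le, abs_lt] at hD
  have h₁ : trueCount (pert σ) - trueCount (obs σ) ≤ ⌊t⌋₊ := by
    rw [Nat.le_floor_iff ht]
    rcases le_total (trueCount (obs σ)) (trueCount (pert σ)) with h | h
    · push_cast [h]; linarith
    · simpa [Nat.sub_eq_zero_of_le h] using ht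
  have h₂ : trueCount (obs σ) - trueCount (pert σ) ≤ ⌊t⌋₊ := by
    rw [Nat.le_floor_iff ht]
    rcases le_total (trueCount (pert σ)) (trueCount (obs σ)) with h | h
    · push_cast [h]; linarith
    · simpa [Nat.sub_eq_zero_of_le h] using ht
  simp only [Set.mem_iUnion, Set.mem_ofPred_eq, exists_prop, exists_eq_right', Finset.mem_Ico]
  omega

lemma noiseμ_maj_obs_ne_maj_pert_le (n : ℕ) {ε a : ℝ} (h0 : 0 ≤ ε) (h1 : ε ≤ 1) (ha : 0 < a) :
    (noiseμ (2 * n + 1) (1 / 2) ε).real {σ | maj n (obs σ) ≠ maj n (pert σ)}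
      ≤ ε / (2 * a ^ 2) + 2 * a := by
  have := isProbabilityMeasure_noiseμ (2 * n + 1) (p := 1 / 2) (by norm_num) (by norm_num) h0 h1
  set r : ℝ := √(2 * n + 1) with hr
  have hr0 : 0 < r := by positivity
  have hrsq : r ^ 2 = 2 * n + 1 := Real.sq_sqrt (by positivity)
  have ht : 0 < a * r := by positivity
  refine (measureReal_mono (setOf_maj_obs_ne_maj_pert_subset n ht.le)).trans ?_
  refine (measureReal_union_le _ _).trans (add_le_add ?_ ?_)
  · refine (noiseμ_le_abs_trueCount_sub_le _ h0 h1 ht).trans_eq ?_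
    rw [mul_pow, hrsq]
    push_cast
    field_simp
  · refine (measureReal_biUnion_finset_le _ _).trans ?_
    refine (Finset.sum_le_sum fun k _ => noiseμ_trueCount_obs_eq_le n k h0 h1).trans ?_
    rw [Finset.sum_const, Nat.card_Ico, nsmul_eq_mul, ← hr]
    have hcard : ((n + 1 + ⌊a * r⌋₊ - (n + 1 - ⌊a * r⌋₊) : ℕ) : ℝ) ≤ 2 * (a * r) := by
      have h : n + 1 + ⌊a * r⌋₊ - (n + 1 - ⌊a * r⌋₊) ≤ 2 * ⌊a * r⌋₊ := by omega
      calc ((n + 1 + ⌊a * r⌋₊ - (n + 1 - ⌊a * r⌋₊) : ℕ) : ℝ) ≤ (2 * ⌊a * r⌋₊ : ℕ) := by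
            exact_mod_cast h
        _ = 2 * (⌊a * r⌋₊ : ℝ) := by push_cast; ring
        _ ≤ 2 * (a * r) := by gcongr; exact Nat.floor_le ht.le
    calc _ ≤ 2 * (a * r) * (1 / r) := by gcongr
      _ = 2 * a := by field_simp

/-- the sequence of majority functions {MAJ_n} over odd numbers of bits is
noise stable with respect to p ≡ 1/2. -/
theorem stmt_3 :
    ∀ δ : ℝ, 0 < δ → ∃ ε : ℝ, 0 < ε ∧ ∀ n : ℕ,
      ((noiseμ (2*n+1) (1/2) ε) {σ | maj n (obs σ) ≠ maj n (pert σ)}).toReal ≤ δ := by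
  intro δ hδ
  have hε : 0 < min 1 (δ * (δ / 4) ^ 2) := by positivity
  refine ⟨min 1 (δ * (δ / 4) ^ 2), hε, fun n => ?_⟩
  refine (noiseμ_maj_obs_ne_maj_pert_le n hε.le (min_le_left _ _)
    (show 0 < δ / 4 by positivity)).trans ?_
  have h : min 1 (δ * (δ / 4) ^ 2) / (2 * (δ / 4) ^ 2) ≤ δ / 2 := by
    rw [div_le_iff₀ (by positivity)]
    linarith [min_le_right 1 (δ * (δ / 4) ^ 2)]
  linarith
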